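/- arXiv:2004.07396 — 2 statements merged into one kernel-verified Lean document; each statement's English description precedes it below -/
import Mathlib

section
/- Let 0<δ<1/2 and U ∈ (0,∞]. For every ε>0 there exists x=x(δ,ε)>0 such that the following holds: for every C¹ function h on [0,U]×[0,∞) with ‖∂_r h‖_{L^∞_U L^{∞,2-δ}_r} < x, the coefficient G=G[h] satisfies, for all (u,r) ∈ [0,U]×[0,∞), both G(u,r) ≤ -(1-ε)·r and |G(u,r)| ≤ (1+ε)·r. -/
open Set MeasureTheory Real Filter

/-- Radial average: `w̄(r) = (1/r)∫₀ʳ w(s) ds` for `r ≠ 0`, with `w̄(0) = w(0)`. -/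
noncomputable def radAvg (w : ℝ → ℝ) (r : ℝ) : ℝ :=
  if r = 0 then w 0 else (∫ s in (0:ℝ)..r, w s) / r

/-- Metric coefficient `f[h](u,r) = exp((1/2)∫₀ʳ (h(u,s)-h̄(u,s))²/s ds)`. -/
noncomputable def metF (h : ℝ → ℝ → ℝ) (u r : ℝ) : ℝ :=
  Real.exp (2⁻¹ * ∫ s in (0:ℝ)..r, (h u s - radAvg (h u) s) ^ 2 / s)

/-- Metric coefficient `f̃[h](u,r) = (1/r)∫₀ʳ (1-3s²) f[h](u,s) ds` (with value `1` at `r=0`). -/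
noncomputable def metFt (h : ℝ → ℝ → ℝ) (u r : ℝ) : ℝ :=
  if r = 0 then 1 else (∫ s in (0:ℝ)..r, (1 - 3 * s ^ 2) * metF h u s) / r

/-- Coefficient `G[h](u,r) = (1/(2r))[(f-f̃)(u,r) - 3 f(u,r) r²]` (with value `0` at `r=0`). -/
noncomputable def coefG (h : ℝ → ℝ → ℝ) (u r : ℝ) : ℝ :=
  if r = 0 then 0 else ((metF h u r - metFt h u r) - 3 * metF h u r * r ^ 2) / (2 * r)

/-- Coefficient `J[h] = 3G[h] + 3 r f[h] - ((1-3r²)/2) ∂_r f[h]`. -/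
noncomputable def coefJ (h : ℝ → ℝ → ℝ) (u r : ℝ) : ℝ :=
  3 * coefG h u r + 3 * r * metF h u r - ((1 - 3 * r ^ 2) / 2) * deriv (fun s => metF h u s) r

theorem abs_mul_sub_integral_le {w : ℝ → ℝ} {x : ℝ} (hw : ContDiff ℝ 1 w)
    (hx : ∀ s, 0 ≤ s → (1 + s) ^ (3 / 2 : ℝ) * |deriv w s| ≤ x) {r : ℝ} (hr : 0 ≤ r) :
    |r * w r - ∫ s in (0:ℝ)..r, w s| ≤ 2 * x * r ^ 2 * (1 + r) ^ (-(3 / 2) : ℝ) := by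
  have hF : ∀ t : ℝ, HasDerivAt (fun t => t * w t - ∫ s in (0:ℝ)..t, w s) (t * deriv w t) t := by
    intro t
    have h1 : HasDerivAt w (deriv w t) t := (hw.differentiable one_ne_zero t).hasDerivAt
    have h2 : HasDerivAt (fun t => ∫ s in (0:ℝ)..t, w s) (w t) t :=
      intervalIntegral.integral_hasDerivAt_right (hw.continuous.intervalIntegrable _ _)
        hw.continuous.stronglyMeasurable.stronglyMeasurableAtFilter hw.continuous.continuousAt
    exact (((hasDerivAt_id t).mul h1).sub h2).congr_deriv (by simp)
  have hB : ∀ t : ℝ, 0 ≤ t → HasDerivAt (fun t => 2 * x * t ^ 2 * (1 + t) ^ (-(3 / 2) : ℝ))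
      (x * t * (1 + t) ^ (-(3 / 2) : ℝ) * ((4 + t) / (1 + t))) t := by
    intro t ht
    have h0 : 0 < 1 + t := by linarith
    have h1 := ((hasDerivAt_id t).const_add 1).rpow_const (p := (-(3 / 2) : ℝ))
      (Or.inl h0.ne')
    have h2 := ((hasDerivAt_pow 2 t).const_mul (2 * x)).mul h1
    refine h2.congr_deriv ?_
    simp only [id]
    rw [Real.rpow_sub_one h0.ne']
    field_simp
    push_cast
    ring
  have key := image_norm_le_of_norm_deriv_right_le_deriv_boundary'
    (f := fun t => t * w t - ∫ s in (0:ℝ)..t, w s) (a := 0) (b := r)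
    (fun t _ => (hF t).continuousAt.continuousWithinAt) (fun t _ => (hF t).hasDerivWithinAt)
    (B := fun t => 2 * x * t ^ 2 * (1 + t) ^ (-(3 / 2) : ℝ)) (by simp)
    (fun t ht => (hB t ht.1).continuousAt.continuousWithinAt)
    (fun t ht => (hB t ht.1).hasDerivWithinAt) ?_ (right_mem_Icc.2 hr)
  · simpa using key
  · rintro t ⟨ht, -⟩
    have h0 : 0 < 1 + t := by linarith
    have hp : 0 < (1 + t) ^ (3 / 2 : ℝ) := Real.rpow_pos_of_pos h0 _
    have hd : |deriv w t| ≤ x * (1 + t) ^ (-(3 / 2) : ℝ) := by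
      rw [Real.rpow_neg h0.le, ← div_eq_mul_inv, le_div_iff₀ hp, mul_comm]
      exact hx t ht
    have hone : 1 ≤ (4 + t) / (1 + t) := by rw [le_div_iff₀ h0]; linarith
    rw [Real.norm_eq_abs, abs_mul, abs_of_nonneg ht]
    have hA : t * |deriv w t| ≤ x * t * (1 + t) ^ (-(3 / 2) : ℝ) := by
      linarith [mul_le_mul_of_nonneg_left hd ht]
    exact hA.trans (le_mul_of_one_le_right (le_trans (by positivity) hA) hone)

theorem sq_sub_radAvg_div_le {w : ℝ → ℝ} {x : ℝ} (hw : ContDiff ℝ 1 w)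
    (hx : ∀ s, 0 ≤ s → (1 + s) ^ (3 / 2 : ℝ) * |deriv w s| ≤ x) {r : ℝ} (hr : 0 < r) :
    (w r - radAvg w r) ^ 2 / r ≤ 4 * x ^ 2 * (r / (1 + r) ^ 3) := by
  have h0 : 0 < 1 + r := by linarith
  have h := abs_mul_sub_integral_le hw hx hr.le
  have hsq := pow_le_pow_left₀ (abs_nonneg _) h 2
  have hc : ((1 + r) ^ (-(3 / 2) : ℝ)) ^ 2 = ((1 + r) ^ 3)⁻¹ := by
    rw [← Real.rpow_natCast, ← Real.rpow_mul h0.le, ← Real.rpow_natCast, ← Real.rpow_neg h0.le]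
    norm_num
  rw [sq_abs, mul_pow, hc] at hsq
  have he : (w r - radAvg w r) ^ 2 / r = (r * w r - ∫ s in (0:ℝ)..r, w s) ^ 2 / r ^ 3 := by
    rw [radAvg, if_neg hr.ne']
    field_simp
  rw [he, div_le_iff₀ (by positivity)]
  refine hsq.trans_eq ?_
  field_simp
  ring

theorem continuousOn_sq_sub_radAvg_div {w : ℝ → ℝ} (hw : Continuous w) :
    ContinuousOn (fun s => (w s - radAvg w s) ^ 2 / s) (Ioi 0) := by
  have h1 : Continuous fun t => ∫ s in (0:ℝ)..t, w s :=
    intervalIntegral.continuous_primitive (fun a b => hw.intervalIntegrable a b) 0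
  have h2 : ContinuousOn (fun s => (w s - (∫ t in (0:ℝ)..s, w t) / s) ^ 2 / s) (Ioi 0) :=
    ((hw.continuousOn.sub (h1.continuousOn.div continuousOn_id fun s hs => (ne_of_gt hs))).pow
      2).div continuousOn_id fun s hs => (ne_of_gt hs)
  refine h2.congr fun s hs => ?_
  simp only [radAvg, if_neg (ne_of_gt (mem_Ioi.1 hs))]

theorem integral_div_one_add_pow_three {r : ℝ} (hr : 0 ≤ r) :
    IntervalIntegrable (fun s : ℝ => s / (1 + s) ^ 3) volume 0 r ∧
      ∫ s in (0:ℝ)..r, s / (1 + s) ^ 3 = r ^ 2 / (2 * (1 + r) ^ 2) := by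
  have hpos : ∀ s ∈ uIcc 0 r, 0 < 1 + s := by
    intro s hs
    rw [uIcc_of_le hr] at hs
    linarith [hs.1]
  have hi : IntervalIntegrable (fun s : ℝ => s / (1 + s) ^ 3) volume 0 r := by
    refine ContinuousOn.intervalIntegrable (ContinuousOn.div (by fun_prop) (by fun_prop) ?_)
    intro s hs
    have := hpos s hs
    positivity
  refine ⟨hi, ?_⟩
  rw [intervalIntegral.integral_eq_sub_of_hasDerivAt
    (f := fun s : ℝ => s ^ 2 / (2 * (1 + s) ^ 2)) (fun s hs => ?_) hi]
  · simp
  · have h0 := hpos s hs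
    have h1 := (hasDerivAt_pow 2 s).div
      ((((hasDerivAt_id' s).const_add 1).pow 2).const_mul 2)
      (show 2 * (1 + s) ^ 2 ≠ 0 by positivity)
    refine h1.congr_deriv ?_
    simp only [Pi.pow_apply]
    field_simp
    push_cast
    ring

theorem integral_sq_sub_radAvg_div_bounds {w : ℝ → ℝ} {x : ℝ} (hw : ContDiff ℝ 1 w)
    (hx : ∀ s, 0 ≤ s → (1 + s) ^ (3 / 2 : ℝ) * |deriv w s| ≤ x) {r : ℝ} (hr : 0 ≤ r) :
    IntervalIntegrable (fun s => (w s - radAvg w s) ^ 2 / s) volume 0 r ∧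
      0 ≤ ∫ s in (0:ℝ)..r, (w s - radAvg w s) ^ 2 / s ∧
      ∫ s in (0:ℝ)..r, (w s - radAvg w s) ^ 2 / s ≤ 2 * x ^ 2 * (r ^ 2 / (1 + r) ^ 2) := by
  obtain ⟨hi, hv⟩ := integral_div_one_add_pow_three hr
  have hnn : ∀ s, 0 ≤ s → 0 ≤ (w s - radAvg w s) ^ 2 / s := fun s hs => by positivity
  have hint : IntervalIntegrable (fun s => (w s - radAvg w s) ^ 2 / s) volume 0 r := by
    refine (hi.const_mul (4 * x ^ 2)).mono_fun' ?_ ?_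
    · rw [uIoc_of_le hr]
      exact ((continuousOn_sq_sub_radAvg_div hw.continuous).mono
        Ioc_subset_Ioi_self).aestronglyMeasurable measurableSet_Ioc
    · rw [uIoc_of_le hr]
      refine (ae_restrict_iff' measurableSet_Ioc).2 (Eventually.of_forall fun s hs => ?_)
      beta_reduce
      rw [Real.norm_eq_abs, abs_of_nonneg (hnn s hs.1.le)]
      exact sq_sub_radAvg_div_le hw hx hs.1
  refine ⟨hint, intervalIntegral.integral_nonneg hr fun s hs => hnn s hs.1, ?_⟩
  calc _ ≤ ∫ s in (0:ℝ)..r, 4 * x ^ 2 * (s / (1 + s) ^ 3) :=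
        intervalIntegral.integral_mono_on_of_le_Ioo hr hint (hi.const_mul _)
          fun s hs => sq_sub_radAvg_div_le hw hx hs.1
    _ = 2 * x ^ 2 * (r ^ 2 / (1 + r) ^ 2) := by
        rw [intervalIntegral.integral_const_mul, hv]
        field_simp
        ring

theorem metF_sub_one_bounds {h : ℝ → ℝ → ℝ} {u x : ℝ} (hw : ContDiff ℝ 1 (h u))
    (hx : ∀ s, 0 ≤ s → (1 + s) ^ (3 / 2 : ℝ) * |deriv (h u) s| ≤ x) (hx1 : x ^ 2 ≤ 1)
    {r : ℝ} (hr : 0 ≤ r) :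
    |metF h u r - 1| ≤ 2 * x ^ 2 ∧ |metF h u r - 1| ≤ 2 * x ^ 2 * r ^ 2 := by
  obtain ⟨-, h0, h1⟩ := integral_sq_sub_radAvg_div_bounds hw hx hr
  have hq1 : r ^ 2 / (1 + r) ^ 2 ≤ 1 := by
    rw [div_le_one (by positivity)]
    nlinarith
  have hq2 : r ^ 2 / (1 + r) ^ 2 ≤ r ^ 2 := div_le_self (sq_nonneg r) (by nlinarith)
  have hb1 := mul_le_mul_of_nonneg_left hq1 (sq_nonneg x)
  have hb2 := mul_le_mul_of_nonneg_left hq2 (sq_nonneg x)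
  rw [metF]
  set I := ∫ s in (0:ℝ)..r, (h u s - radAvg (h u) s) ^ 2 / s
  have hI : |2⁻¹ * I| ≤ 1 := by
    rw [abs_of_nonneg (by positivity)]
    linarith
  have he := Real.abs_exp_sub_one_le hI
  rw [abs_of_nonneg (show 0 ≤ 2⁻¹ * I by positivity)] at he
  constructor <;> linarith

theorem continuousOn_metF {h : ℝ → ℝ → ℝ} {u x : ℝ} (hw : ContDiff ℝ 1 (h u))
    (hx : ∀ s, 0 ≤ s → (1 + s) ^ (3 / 2 : ℝ) * |deriv (h u) s| ≤ x) {r : ℝ} (hr : 0 ≤ r) :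
    ContinuousOn (metF h u) (uIcc 0 r) := by
  have hc := intervalIntegral.continuousOn_primitive_interval'
    (integral_sq_sub_radAvg_div_bounds hw hx hr).1 left_mem_uIcc
  exact (continuousOn_const.mul hc).rexp

theorem abs_coefG_add_le {h : ℝ → ℝ → ℝ} {u x : ℝ} (hw : ContDiff ℝ 1 (h u))
    (hx : ∀ s, 0 ≤ s → (1 + s) ^ (3 / 2 : ℝ) * |deriv (h u) s| ≤ x) (hx1 : x ^ 2 ≤ 1)
    {r : ℝ} (hr : 0 ≤ r) :
    |coefG h u r + r| ≤ 8 * x ^ 2 * r := by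
  rcases hr.eq_or_lt with rfl | hpos
  · simp [coefG]
  have hcont := continuousOn_metF hw hx hr
  obtain ⟨e1, e2⟩ := metF_sub_one_bounds hw hx hx1 hr
  set E := ∫ s in (0:ℝ)..r, (1 - 3 * s ^ 2) * (metF h u s - 1) with hE
  have hEb : |E| ≤ 8 * x ^ 2 * r ^ 2 * r := by
    have := intervalIntegral.norm_integral_le_of_norm_le_const (a := 0) (b := r)
      (f := fun s => (1 - 3 * s ^ 2) * (metF h u s - 1)) (C := 8 * x ^ 2 * r ^ 2) ?_
    · simpa [abs_of_pos hpos] using this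
    · intro s hs
      rw [uIoc_of_le hr] at hs
      obtain ⟨f1, f2⟩ := metF_sub_one_bounds hw hx hx1 hs.1.le
      have hs2 : s ^ 2 ≤ r ^ 2 := pow_le_pow_left₀ hs.1.le hs.2 2
      have hA : |1 - 3 * s ^ 2| ≤ 1 + 3 * s ^ 2 := by
        rw [abs_le]
        constructor <;> nlinarith [sq_nonneg s]
      rw [Real.norm_eq_abs, abs_mul]
      have h3 := mul_le_mul_of_nonneg_right hA (abs_nonneg (metF h u s - 1))
      have h4 := mul_le_mul_of_nonneg_left f1 (sq_nonneg s)
      have h5 := mul_le_mul_of_nonneg_left hs2 (sq_nonneg x)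
      linarith
  have hsplit : ∫ s in (0:ℝ)..r, (1 - 3 * s ^ 2) * metF h u s = r - r ^ 3 + E := by
    have hp : ∫ s in (0:ℝ)..r, (1 - 3 * s ^ 2) = r - r ^ 3 := by
      rw [intervalIntegral.integral_sub (by simp)
        (Continuous.intervalIntegrable (by fun_prop) _ _)]
      simp
      ring
    rw [← hp, hE, ← intervalIntegral.integral_add
      (Continuous.intervalIntegrable (by fun_prop) _ _)
      (ContinuousOn.intervalIntegrable (by fun_prop))]
    congr 1
    ext s
    ring
  have hG : coefG h u r + r
      = ((metF h u r - 1) - E / r - 3 * r ^ 2 * (metF h u r - 1)) / (2 * r) := by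
    rw [coefG, metFt, if_neg hpos.ne', if_neg hpos.ne', hsplit]
    field_simp
    ring
  have hE' : |E / r| ≤ 8 * x ^ 2 * r ^ 2 := by
    rwa [abs_div, abs_of_pos hpos, div_le_iff₀ hpos]
  rw [hG, abs_div, abs_of_pos (by positivity : 0 < 2 * r), div_le_iff₀ (by positivity)]
  have h6 : |3 * r ^ 2 * (metF h u r - 1)| ≤ 3 * r ^ 2 * (2 * x ^ 2) := by
    rw [abs_mul, abs_of_nonneg (by positivity : 0 ≤ 3 * r ^ 2)]
    gcongr
  have t1 := abs_sub (metF h u r - 1 - E / r) (3 * r ^ 2 * (metF h u r - 1))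
  have t2 := abs_sub (metF h u r - 1) (E / r)
  linarith

theorem coefG_bounds (δ : ℝ) (hδ₁ : 0 < δ) (hδ₂ : δ < 1/2) (ε : ℝ) (hε : 0 < ε) :
    ∃ x > (0:ℝ), ∀ U : ENNReal, 0 < U → ∀ h : ℝ → ℝ → ℝ,
      ContDiff ℝ 1 (Function.uncurry h) →
      (∀ u r : ℝ, 0 ≤ u → ENNReal.ofReal u ≤ U → 0 ≤ r →
        (1 + r) ^ (2 - δ) * |deriv (h u) r| ≤ x) →
      ∀ u r : ℝ, 0 ≤ u → ENNReal.ofReal u ≤ U → 0 ≤ r →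
        coefG h u r ≤ -(1 - ε) * r ∧ |coefG h u r| ≤ (1 + ε) * r := by
  have hx0 : 0 < min 1 (ε / 8) := by positivity
  refine ⟨min 1 (ε / 8), hx0, ?_⟩
  intro U _ h hh hb u r hu huU hr
  set x := min 1 (ε / 8)
  have hx1 : x ≤ 1 := min_le_left _ _
  have hx2 : x ≤ ε / 8 := min_le_right _ _
  have hw : ContDiff ℝ 1 (h u) := hh.comp (contDiff_const.prodMk contDiff_id)
  have hd : ∀ s, 0 ≤ s → (1 + s) ^ (3 / 2 : ℝ) * |deriv (h u) s| ≤ x := fun s hs =>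
    le_trans (mul_le_mul_of_nonneg_right
      (Real.rpow_le_rpow_of_exponent_le (by linarith) (by linarith)) (abs_nonneg _))
      (hb u s hu huU hs)
  have key := abs_coefG_add_le hw hd (pow_le_one₀ hx0.le hx1) hr
  have hε' : 8 * x ^ 2 * r ≤ ε * r := by
    gcongr
    nlinarith
  have hεr : 0 ≤ ε * r := by positivity
  obtain ⟨k1, k2⟩ := abs_le.1 (key.trans hε')
  refine ⟨by linarith, abs_le.2 ⟨by linarith, by linarith⟩⟩
end

section
/- Let 0<δ<1/2 and U ∈ (0,∞]. There exist constants x=x(δ)>0 and C_δ>0 such that for every C¹ function h on [0,U]×[0,∞) with ‖∂_r h‖_{L^∞_U L^{∞,2-δ}_r} < x, the coefficient J=J[h] satisfies |J(u,r)| ≤ C_δ (1+r)^{2δ-1} ‖∂_r h‖²_{L^∞_U L^{∞,2-δ}_r} for all (u,r) ∈ [0,U]×[0,∞). -/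
open Set MeasureTheory Real Filter

/-- The remainder `∫₀¹ θ w'(θ s) dθ`, which satisfies `w s - w̄ s = s * avgSlope w s`. -/
noncomputable def avgSlope (w : ℝ → ℝ) (s : ℝ) : ℝ :=
  ∫ θ in (0:ℝ)..1, θ * deriv w (θ * s)

theorem continuous_avgSlope {w : ℝ → ℝ} (hw : ContDiff ℝ 1 w) : Continuous (avgSlope w) := by
  have hd : Continuous (deriv w) := hw.continuous_deriv le_rfl
  unfold avgSlope
  exact intervalIntegral.continuous_parametric_intervalIntegral_of_continuous' (by fun_prop) 0 1

theorem sq_mul_avgSlope (w : ℝ → ℝ) (s : ℝ) :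
    s ^ 2 * avgSlope w s = ∫ t in (0:ℝ)..s, t * deriv w t := by
  have h := intervalIntegral.mul_integral_comp_mul_right (a := 0) (b := 1)
    (f := fun t => t * deriv w t) s
  simp only [zero_mul, one_mul] at h
  rw [← h, avgSlope, sq, mul_assoc, ← intervalIntegral.integral_const_mul]
  congr 2
  ext θ
  ring

theorem sub_radAvg_eq {w : ℝ → ℝ} (hw : ContDiff ℝ 1 w) (s : ℝ) :
    w s - radAvg w s = s * avgSlope w s := by
  rcases eq_or_ne s 0 with rfl | hs
  · simp [radAvg]
  have hd : Continuous (deriv w) := hw.continuous_deriv le_rfl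
  have hp : ∫ t in (0:ℝ)..s, t * deriv w t = s * w s - 0 * w 0 - ∫ t in (0:ℝ)..s, 1 * w t :=
    intervalIntegral.integral_mul_deriv_eq_deriv_mul (u := fun t => t) (u' := fun _ => 1)
      (fun x _ => hasDerivAt_id x)
      (fun x _ => (hw.differentiable one_ne_zero x).hasDerivAt)
      intervalIntegrable_const (hd.intervalIntegrable _ _)
  rw [← sq_mul_avgSlope] at hp
  simp only [zero_mul, sub_zero, one_mul] at hp
  rw [radAvg, if_neg hs]
  field_simp
  linarith

theorem metF_eq {h : ℝ → ℝ → ℝ} {u : ℝ} (hw : ContDiff ℝ 1 (h u)) (r : ℝ) :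
    metF h u r = exp (2⁻¹ * ∫ s in (0:ℝ)..r, s * avgSlope (h u) s ^ 2) := by
  rw [metF]
  congr 3
  ext s
  rw [sub_radAvg_eq hw]
  rcases eq_or_ne s 0 with rfl | hs
  · simp
  · field_simp

theorem hasDerivAt_metF {h : ℝ → ℝ → ℝ} {u : ℝ} (hw : ContDiff ℝ 1 (h u)) (r : ℝ) :
    HasDerivAt (metF h u) (metF h u r * (2⁻¹ * (r * avgSlope (h u) r ^ 2))) r := by
  have hm := continuous_avgSlope hw
  have hc : Continuous fun s => s * avgSlope (h u) s ^ 2 := by fun_prop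
  have hI := ((hc.integral_hasStrictDerivAt 0 r).hasDerivAt.const_mul (2⁻¹ : ℝ)).exp
  rw [← metF_eq hw r] at hI
  exact hI.congr_of_eventuallyEq (Eventually.of_forall fun s => metF_eq hw s)

theorem coefJ_eq {h : ℝ → ℝ → ℝ} {u : ℝ} (hw : ContDiff ℝ 1 (h u)) {r : ℝ} (hr : r ≠ 0) :
    coefJ h u r = 3 / (2 * r ^ 2) * (∫ s in (0:ℝ)..r, (s - s ^ 3) * deriv (metF h u) s)
      - (1 - 3 * r ^ 2) / 2 * deriv (metF h u) r := by
  have hm := continuous_avgSlope hw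
  have hf : Continuous (metF h u) :=
    continuous_iff_continuousAt.2 fun x => (hasDerivAt_metF hw x).continuousAt
  have hder : deriv (metF h u) = fun s => metF h u s * (2⁻¹ * (s * avgSlope (h u) s ^ 2)) :=
    funext fun s => (hasDerivAt_metF hw s).deriv
  have hf' : Continuous (deriv (metF h u)) := by rw [hder]; fun_prop
  have hq : Continuous fun s : ℝ => 1 - 3 * s ^ 2 := by fun_prop
  have hp : ∫ s in (0:ℝ)..r, (s - s ^ 3) * deriv (metF h u) s
      = (r - r ^ 3) * metF h u r - (0 - 0 ^ 3) * metF h u 0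
        - ∫ s in (0:ℝ)..r, (1 - 3 * s ^ 2) * metF h u s :=
    intervalIntegral.integral_mul_deriv_eq_deriv_mul (u := fun s => s - s ^ 3)
      (u' := fun s => 1 - 3 * s ^ 2)
      (fun x _ => by simpa using (hasDerivAt_id' x).fun_sub (hasDerivAt_pow 3 x))
      (fun x _ => (hasDerivAt_metF hw x).differentiableAt.hasDerivAt)
      (hq.intervalIntegrable _ _) (hf'.intervalIntegrable _ _)
  rw [hp, coefJ, coefG, metFt, if_neg hr, if_neg hr]
  field_simp
  ring

/-- Comparison of an integral over `[0, r]` with a primitive `B` of a majorant. -/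
theorem abs_integral_le_of_abs_le_deriv {φ B B' : ℝ → ℝ} {r : ℝ} (hr : 0 ≤ r)
    (hφ : Continuous φ) (h0 : 0 ≤ B 0) (hB : ∀ x, 0 ≤ x → HasDerivAt B (B' x) x)
    (bound : ∀ x, 0 ≤ x → |φ x| ≤ B' x) :
    |∫ s in (0:ℝ)..r, φ s| ≤ B r := by
  have hI : ∀ x, HasDerivAt (fun x => ∫ s in (0:ℝ)..x, φ s) (φ x) x :=
    fun x => (hφ.integral_hasStrictDerivAt 0 x).hasDerivAt
  exact image_norm_le_of_norm_deriv_right_le_deriv_boundary'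
    (f := fun x => ∫ s in (0:ℝ)..x, φ s) (f' := φ) (B := B) (B' := B') (a := 0) (b := r)
    (fun x _ => (hI x).continuousAt.continuousWithinAt)
    (fun x _ => (hI x).hasDerivWithinAt)
    (by simpa using h0)
    (fun x hx => (hB x hx.1).continuousAt.continuousWithinAt)
    (fun x hx => (hB x hx.1).hasDerivWithinAt)
    (fun x hx => bound x hx.1) ⟨hr, le_rfl⟩

theorem hasDerivAt_one_add_rpow {x : ℝ} (hx : 0 ≤ x) (p : ℝ) :
    HasDerivAt (fun r : ℝ => (1 + r) ^ p) (p * (1 + x) ^ (p - 1)) x := by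
  have h := ((hasDerivAt_id x).const_add 1).rpow_const (p := p)
    (Or.inl (show (1 + id x : ℝ) ≠ 0 by simp only [id]; positivity))
  simpa using h

theorem hasDerivAt_sq_mul_one_add_rpow {x : ℝ} (hx : 0 ≤ x) (p : ℝ) :
    HasDerivAt (fun r : ℝ => r ^ 2 * (1 + r) ^ p)
      (x * (1 + x) ^ (p - 1) * (2 + (2 + p) * x)) x := by
  refine ((hasDerivAt_pow 2 x).fun_mul (hasDerivAt_one_add_rpow hx p)).congr_deriv ?_
  have h1 : (1 + x) ^ p = (1 + x) ^ (p - 1) * (1 + x) := by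
    rw [← rpow_add_one (by positivity)]; congr 1; ring
  rw [h1]
  push_cast
  ring

theorem abs_avgSlope_le {w : ℝ → ℝ} (hw : ContDiff ℝ 1 w) {δ N : ℝ} (hδ : 0 < δ) (hδ' : δ < 2)
    (hb : ∀ r, 0 ≤ r → (1 + r) ^ (2 - δ) * |deriv w r| ≤ N) {r : ℝ} (hr : 0 < r) :
    |avgSlope w r| ≤ N / δ * (1 + r) ^ (δ - 2) := by
  have hd : Continuous (deriv w) := hw.continuous_deriv le_rfl
  have hb' : ∀ x, 0 ≤ x → |deriv w x| ≤ N * (1 + x) ^ (δ - 2) := fun x hx => by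
    have h1 : (0:ℝ) < 1 + x := by positivity
    have := hb x hx
    rw [show δ - 2 = -(2 - δ) by ring, rpow_neg h1.le, ← div_eq_mul_inv,
      le_div_iff₀ (rpow_pos_of_pos h1 _), mul_comm]
    exact this
  have hN : 0 ≤ N := le_trans (by positivity) (hb 0 le_rfl)
  have key := abs_integral_le_of_abs_le_deriv (φ := fun t => t * deriv w t) hr.le (by fun_prop)
    (B := fun r => N / δ * (r ^ 2 * (1 + r) ^ (δ - 2))) (by simp)
    (fun x hx => (hasDerivAt_sq_mul_one_add_rpow hx (δ - 2)).const_mul (N / δ))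
    (fun x hx => by
      have h1 : (1 + x) ^ (δ - 2) = (1 + x) ^ (δ - 2 - 1) * (1 + x) := by
        rw [← rpow_add_one (by positivity)]; congr 1; ring
      have h2 := hb' x hx
      rw [h1] at h2
      have h3 : 0 < (1 + x) ^ (δ - 2 - 1) := rpow_pos_of_pos (by positivity) _
      rw [abs_mul, abs_of_nonneg hx]
      calc x * |deriv w x| ≤ x * (N * ((1 + x) ^ (δ - 2 - 1) * (1 + x))) := by gcongr
        _ = N / δ * (x * (1 + x) ^ (δ - 2 - 1) * (δ + δ * x)) := by field_simp
        _ ≤ N / δ * (x * (1 + x) ^ (δ - 2 - 1) * (2 + (2 + (δ - 2)) * x)) := by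
            gcongr
            linarith)
  rw [← sq_mul_avgSlope, abs_mul, abs_of_nonneg (sq_nonneg r)] at key
  have hr2 : 0 < r ^ 2 := by positivity
  refine le_of_mul_le_mul_left (key.trans_eq ?_) hr2
  ring

theorem mul_avgSlope_sq_le {w : ℝ → ℝ} (hw : ContDiff ℝ 1 w) {δ N : ℝ} (hδ : 0 < δ) (hδ' : δ < 2)
    (hb : ∀ r, 0 ≤ r → (1 + r) ^ (2 - δ) * |deriv w r| ≤ N) {r : ℝ} (hr : 0 ≤ r) :
    r * avgSlope w r ^ 2 ≤ (N / δ) ^ 2 * (r * (1 + r) ^ (2 * δ - 4)) := by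
  rcases hr.eq_or_lt with rfl | hr
  · simp
  have h := pow_le_pow_left₀ (abs_nonneg _) (abs_avgSlope_le hw hδ hδ' hb hr) 2
  rw [sq_abs, mul_pow, ← rpow_mul_natCast (by positivity)] at h
  push_cast at h
  rw [show (δ - 2) * 2 = 2 * δ - 4 by ring] at h
  calc r * avgSlope w r ^ 2 ≤ r * ((N / δ) ^ 2 * (1 + r) ^ (2 * δ - 4)) := by gcongr
    _ = _ := by ring

theorem metF_le {h : ℝ → ℝ → ℝ} {u δ N : ℝ} (hw : ContDiff ℝ 1 (h u)) (hδ : 0 < δ)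
    (hδ' : δ < 1 / 2) (hN : N ≤ δ)
    (hb : ∀ r, 0 ≤ r → (1 + r) ^ (2 - δ) * |deriv (h u) r| ≤ N) {r : ℝ} (hr : 0 ≤ r) :
    metF h u r ≤ exp 1 := by
  have hm := continuous_avgSlope hw
  have hN0 : 0 ≤ N := le_trans (by positivity) (hb 0 le_rfl)
  have hNδ : (N / δ) ^ 2 ≤ 1 := pow_le_one₀ (by positivity) (by rwa [div_le_one hδ])
  have key := abs_integral_le_of_abs_le_deriv (φ := fun s => s * avgSlope (h u) s ^ 2) hr
    (by fun_prop)
    (B := fun r => 1 - (1 + r) ^ (-1 : ℝ)) (by simp)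
    (fun x hx => (hasDerivAt_one_add_rpow hx (-1)).const_sub 1)
    (fun x hx => by
      have h1 : (0:ℝ) < 1 + x := by positivity
      rw [abs_of_nonneg (by positivity)]
      calc x * avgSlope (h u) x ^ 2
          ≤ (N / δ) ^ 2 * (x * (1 + x) ^ (2 * δ - 4)) :=
            mul_avgSlope_sq_le hw hδ (by linarith) hb hx
        _ ≤ 1 * ((1 + x) * (1 + x) ^ (2 * δ - 4)) := by
            gcongr
            linarith
        _ = (1 + x) ^ (2 * δ - 3) := by
            rw [one_mul, mul_comm, ← rpow_add_one h1.ne']; congr 1; ring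
        _ ≤ (1 + x) ^ (-1 - 1 : ℝ) := rpow_le_rpow_of_exponent_le (by linarith) (by linarith)
        _ = -(-1 * (1 + x) ^ (-1 - 1 : ℝ)) := by ring)
  rw [metF_eq hw]
  apply exp_le_exp.2
  have h1 : 0 < (1 + r) ^ (-1 : ℝ) := rpow_pos_of_pos (by positivity) _
  have h2 := (le_abs_self _).trans key
  linarith

theorem abs_deriv_metF_le {h : ℝ → ℝ → ℝ} {u δ N : ℝ} (hw : ContDiff ℝ 1 (h u)) (hδ : 0 < δ)
    (hδ' : δ < 1 / 2) (hN : N ≤ δ)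
    (hb : ∀ r, 0 ≤ r → (1 + r) ^ (2 - δ) * |deriv (h u) r| ≤ N) {r : ℝ} (hr : 0 ≤ r) :
    |deriv (metF h u) r| ≤ exp 1 * (N / δ) ^ 2 * (r * (1 + r) ^ (2 * δ - 4)) := by
  have hpos : 0 < metF h u r := exp_pos _
  rw [(hasDerivAt_metF hw r).deriv, abs_of_nonneg (by positivity), mul_assoc (exp 1)]
  have h1 := mul_avgSlope_sq_le hw hδ (by linarith) hb hr
  have h2 : 0 ≤ r * avgSlope (h u) r ^ 2 := by positivity
  exact mul_le_mul (metF_le hw hδ hδ' hN hb hr) (by linarith) (by positivity) (exp_pos _).le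

theorem abs_coefJ_le {h : ℝ → ℝ → ℝ} {u δ N : ℝ} (hw : ContDiff ℝ 1 (h u)) (hδ : 0 < δ)
    (hδ' : δ < 1 / 2) (hN : N ≤ δ)
    (hb : ∀ r, 0 ≤ r → (1 + r) ^ (2 - δ) * |deriv (h u) r| ≤ N) {r : ℝ} (hr : 0 ≤ r) :
    |coefJ h u r| ≤ 3 * (exp 1 * (N / δ) ^ 2) * (1 + r) ^ (2 * δ - 1) := by
  set K := exp 1 * (N / δ) ^ 2 with hK
  have hK0 : 0 ≤ K := by positivity
  have hD : ∀ x, 0 ≤ x → |deriv (metF h u) x| ≤ K * (x * (1 + x) ^ (2 * δ - 4)) :=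
    fun x hx => abs_deriv_metF_le hw hδ hδ' hN hb hx
  have hm := continuous_avgSlope hw
  have hf : Continuous (metF h u) :=
    continuous_iff_continuousAt.2 fun x => (hasDerivAt_metF hw x).continuousAt
  have hder : deriv (metF h u) = fun s => metF h u s * (2⁻¹ * (s * avgSlope (h u) s ^ 2)) :=
    funext fun s => (hasDerivAt_metF hw s).deriv
  have hf' : Continuous (deriv (metF h u)) := by rw [hder]; fun_prop
  have hpow : ∀ x : ℝ, 0 ≤ x → ∀ (p : ℝ) (n : ℕ), (1 + x) ^ (p + n) = (1 + x) ^ p * (1 + x) ^ n :=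
    fun x hx p n => rpow_add_natCast (by positivity) p n
  rcases hr.eq_or_lt with rfl | hr
  · have h0 : deriv (metF h u) 0 = 0 := by rw [hder]; simp
    have : coefJ h u 0 = 0 := by
      rw [coefJ, coefG, if_pos rfl, show deriv (fun s => metF h u s) 0 = 0 from h0]
      ring
    rw [this, abs_zero]
    positivity
  have hI := abs_integral_le_of_abs_le_deriv
    (φ := fun s => (s - s ^ 3) * deriv (metF h u) s) hr.le (by fun_prop)
    (B := fun r => K * (r ^ 2 * (1 + r) ^ (2 * δ - 1))) (by simp)
    (fun x hx => (hasDerivAt_sq_mul_one_add_rpow hx (2 * δ - 1)).const_mul K)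
    (fun x hx => by
      have e := hpow x hx (2 * δ - 4) 2
      rw [show 2 * δ - 4 + (2 : ℕ) = 2 * δ - 1 - 1 by push_cast; ring] at e
      have h1 : |x - x ^ 3| ≤ x * (1 + x) ^ 2 := by
        rw [abs_le]
        constructor <;> nlinarith [pow_nonneg hx 2, pow_nonneg hx 3]
      have hp : 0 < (1 + x) ^ (2 * δ - 4) := rpow_pos_of_pos (by positivity) _
      rw [abs_mul, e]
      calc |x - x ^ 3| * |deriv (metF h u) x|
          ≤ (x * (1 + x) ^ 2) * (K * (x * (1 + x) ^ (2 * δ - 4))) :=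
            mul_le_mul h1 (hD x hx) (abs_nonneg _) (by positivity)
        _ = K * (x * ((1 + x) ^ (2 * δ - 4) * (1 + x) ^ 2) * x) := by ring
        _ ≤ _ := by
            gcongr
            nlinarith)
  have hL : |(1 - 3 * r ^ 2) / 2 * deriv (metF h u) r|
      ≤ 3 / 2 * (K * (1 + r) ^ (2 * δ - 1)) := by
    have e := hpow r hr.le (2 * δ - 4) 3
    rw [show 2 * δ - 4 + (3 : ℕ) = 2 * δ - 1 by push_cast; ring] at e
    have h1 : |(1 - 3 * r ^ 2) / 2| ≤ 3 / 2 * (1 + r) ^ 2 := by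
      rw [abs_le]
      constructor <;> nlinarith
    have hp : 0 < (1 + r) ^ (2 * δ - 4) := rpow_pos_of_pos (by positivity) _
    rw [abs_mul, e]
    calc |(1 - 3 * r ^ 2) / 2| * |deriv (metF h u) r|
        ≤ (3 / 2 * (1 + r) ^ 2) * (K * (r * (1 + r) ^ (2 * δ - 4))) :=
          mul_le_mul h1 (hD r hr.le) (abs_nonneg _) (by positivity)
      _ ≤ (3 / 2 * (1 + r) ^ 2) * (K * ((1 + r) * (1 + r) ^ (2 * δ - 4))) := by
          gcongr
          linarith
      _ = _ := by ring
  rw [coefJ_eq hw hr.ne']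
  calc _ ≤ |3 / (2 * r ^ 2) * (∫ s in (0:ℝ)..r, (s - s ^ 3) * deriv (metF h u) s)|
        + |(1 - 3 * r ^ 2) / 2 * deriv (metF h u) r| := abs_sub _ _
    _ ≤ 3 / (2 * r ^ 2) * (K * (r ^ 2 * (1 + r) ^ (2 * δ - 1)))
        + 3 / 2 * (K * (1 + r) ^ (2 * δ - 1)) := by
        rw [abs_mul, abs_of_nonneg (show 0 ≤ 3 / (2 * r ^ 2) by positivity)]
        gcongr
    _ = _ := by
        field_simp
        ring

theorem coefJ_bound (δ : ℝ) (hδ₁ : 0 < δ) (hδ₂ : δ < 1/2) :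
    ∃ x > (0:ℝ), ∃ C > (0:ℝ), ∀ U : ENNReal, 0 < U → ∀ h : ℝ → ℝ → ℝ,
      ContDiff ℝ 1 (Function.uncurry h) →
      ∀ N : ℝ, 0 ≤ N → N < x →
      (∀ u r : ℝ, 0 ≤ u → ENNReal.ofReal u ≤ U → 0 ≤ r →
        (1 + r) ^ (2 - δ) * |deriv (h u) r| ≤ N) →
      ∀ u r : ℝ, 0 ≤ u → ENNReal.ofReal u ≤ U → 0 ≤ r →
        |coefJ h u r| ≤ C * (1 + r) ^ (2 * δ - 1) * N ^ 2 := by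
  refine ⟨δ, hδ₁, 3 * exp 1 / δ ^ 2, by positivity, ?_⟩
  intro U _ h hh N _ hN hb u r hu huU hr
  have hw : ContDiff ℝ 1 (h u) :=
    hh.comp (contDiff_const.prodMk contDiff_id : ContDiff ℝ 1 fun r : ℝ => (u, r))
  refine (abs_coefJ_le hw hδ₁ hδ₂ hN.le (fun r hr => hb u r hu huU hr) hr).trans_eq ?_
  rw [div_pow]
  ring
end
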